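/- Let 1 ≤ r < s ≤ ∞ and let P be a real-linear map on the real vector space H_n of n×n complex Hermitian matrices that is positive, i.e. P(X) is positive semidefinite whenever X is positive semidefinite. Let P* denote the adjoint of P with respect to the trace inner product (tr(P(X)Y) = tr(X P*(Y)) for all Hermitian X, Y), and let I be the n×n identity matrix. Then ‖P‖_{r→s} ≤ 2√2 · ‖P(I)‖_∞^{1−1/r} · ‖P*(I)‖_∞^{1/r} (convention 1/∞ = 0). -/

import Mathlib

open scoped ENNReal ComplexOrder

/-- The spectral `p`-norm of a Hermitian matrix: the `p`-norm of its eigenvalue vector.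
(Junk value `0` for non-Hermitian matrices.) -/
noncomputable def specPNorm {n : ℕ} (p : ℝ≥0∞) (A : Matrix (Fin n) (Fin n) ℂ) : ℝ :=
  if hA : A.IsHermitian then
    (if p = ∞ then ⨆ i, |hA.eigenvalues i|
     else (∑ i, |hA.eigenvalues i| ^ p.toReal) ^ (1 / p.toReal))
  else 0

/-- The operator norm of a real-linear map on Hermitian matrices (represented as a real-linear
map on all matrices), from the spectral `r`-norm to the spectral `s`-norm: the supremum of
`‖T A‖_s / ‖A‖_r` over nonzero Hermitian `A`. -/
noncomputable def hermOpNorm {n : ℕ} (r s : ℝ≥0∞)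
    (T : Matrix (Fin n) (Fin n) ℂ →ₗ[ℝ] Matrix (Fin n) (Fin n) ℂ) : ℝ :=
  ⨆ A : {A : Matrix (Fin n) (Fin n) ℂ // A.IsHermitian ∧ A ≠ 0},
    specPNorm s (T A.1) / specPNorm r A.1

open Matrix

/-- The `ℓ^p` quasi-norms of a nonnegative finite family decrease in the exponent. -/
lemma sum_rpow_rpow_inv_le {ι : Type*} [Fintype ι] {f : ι → ℝ} (hf : ∀ i, 0 ≤ f i) {p q : ℝ}
    (hp : 0 < p) (hpq : p ≤ q) :
    (∑ i, f i ^ q) ^ (1 / q) ≤ (∑ i, f i ^ p) ^ (1 / p) := by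
  have hq : 0 < q := hp.trans_le hpq
  have hS : 0 ≤ ∑ i, f i ^ p := Finset.sum_nonneg fun i _ => Real.rpow_nonneg (hf i) p
  set N := (∑ i, f i ^ p) ^ (1 / p) with hN
  have hN0 : 0 ≤ N := Real.rpow_nonneg hS _
  have hNp : N ^ p = ∑ i, f i ^ p := by
    rw [hN, ← Real.rpow_mul hS, one_div_mul_cancel hp.ne', Real.rpow_one]
  have hfN (i : ι) : f i ≤ N := by
    rw [← Real.rpow_le_rpow_iff (hf i) hN0 hp, hNp]
    exact Finset.single_le_sum (f := fun i => f i ^ p)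
      (fun j _ => Real.rpow_nonneg (hf j) p) (Finset.mem_univ i)
  have hsplit {x : ℝ} (hx : 0 ≤ x) : x ^ q = x ^ p * x ^ (q - p) := by
    rw [← Real.rpow_add' hx (by linarith), add_sub_cancel]
  have hle : ∑ i, f i ^ q ≤ N ^ q := by
    rw [hsplit hN0, hNp, Finset.sum_mul]
    refine Finset.sum_le_sum fun i _ => ?_
    rw [hsplit (hf i)]
    exact mul_le_mul_of_nonneg_left (Real.rpow_le_rpow (hf i) (hfN i) (by linarith))
      (Real.rpow_nonneg (hf i) p)
  calc (∑ i, f i ^ q) ^ (1 / q) ≤ (N ^ q) ^ (1 / q) :=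
        Real.rpow_le_rpow (Finset.sum_nonneg fun i _ => Real.rpow_nonneg (hf i) q) hle
          (by positivity)
    _ = N := by rw [← Real.rpow_mul hN0, mul_one_div_cancel hq.ne', Real.rpow_one]

/-- **Schur test**: a nonnegative matrix with row sums at most `a` and column sums at most `b`
has norm at most `a ^ (1 - 1 / p) * b ^ (1 / p)` on `ℓ^p`. -/
lemma schur_test {ι κ : Type*} [Fintype ι] [Fintype κ] {M : κ → ι → ℝ} (hM : ∀ j i, 0 ≤ M j i)
    {a b p : ℝ} (ha : 0 ≤ a) (hb : 0 ≤ b) (hp : 1 ≤ p) (hrow : ∀ j, ∑ i, M j i ≤ a)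
    (hcol : ∀ i, ∑ j, M j i ≤ b) (x : ι → ℝ) :
    (∑ j, |∑ i, M j i * x i| ^ p) ^ (1 / p) ≤
      a ^ (1 - 1 / p) * b ^ (1 / p) * (∑ i, |x i| ^ p) ^ (1 / p) := by
  have hp0 : 0 < p := by linarith
  have hexp : 0 ≤ 1 - p⁻¹ := sub_nonneg.2 (inv_le_one_of_one_le₀ hp)
  have hx (i : ι) : 0 ≤ |x i| ^ p := Real.rpow_nonneg (abs_nonneg _) p
  have hMx (j : κ) : 0 ≤ ∑ i, M j i * |x i| ^ p :=
    Finset.sum_nonneg fun i _ => mul_nonneg (hM j i) (hx i)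
  have hrow_bound (j : κ) :
      |∑ i, M j i * x i| ^ p ≤ (a ^ (1 - p⁻¹)) ^ p * ∑ i, M j i * |x i| ^ p := by
    calc |∑ i, M j i * x i| ^ p
        ≤ (a ^ (1 - p⁻¹) * (∑ i, M j i * |x i| ^ p) ^ p⁻¹) ^ p := by
          refine Real.rpow_le_rpow (abs_nonneg _) ?_ hp0.le
          calc |∑ i, M j i * x i| ≤ ∑ i, M j i * |x i| := by
                refine (Finset.abs_sum_le_sum_abs _ _).trans_eq (Finset.sum_congr rfl fun i _ => ?_)
                rw [abs_mul, abs_of_nonneg (hM j i)]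
            _ ≤ (∑ i, M j i) ^ (1 - p⁻¹) * (∑ i, M j i * |x i| ^ p) ^ p⁻¹ :=
                Real.inner_le_weight_mul_Lp_of_nonneg _ hp _ _ (hM j) fun i => abs_nonneg _
            _ ≤ a ^ (1 - p⁻¹) * (∑ i, M j i * |x i| ^ p) ^ p⁻¹ :=
                mul_le_mul_of_nonneg_right
                  (Real.rpow_le_rpow (Finset.sum_nonneg fun i _ => hM j i) (hrow j) hexp)
                  (Real.rpow_nonneg (hMx j) _)
      _ = (a ^ (1 - p⁻¹)) ^ p * ∑ i, M j i * |x i| ^ p := by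
          rw [Real.mul_rpow (Real.rpow_nonneg ha _) (Real.rpow_nonneg (hMx j) _),
            ← Real.rpow_mul (hMx j), inv_mul_cancel₀ hp0.ne', Real.rpow_one]
  have hsum : ∑ j, |∑ i, M j i * x i| ^ p ≤ (a ^ (1 - p⁻¹)) ^ p * (b * ∑ i, |x i| ^ p) := by
    refine (Finset.sum_le_sum fun j _ => hrow_bound j).trans ?_
    rw [← Finset.mul_sum, Finset.sum_comm, Finset.mul_sum Finset.univ _ b]
    refine mul_le_mul_of_nonneg_left (Finset.sum_le_sum fun i _ => ?_)
      (Real.rpow_nonneg (Real.rpow_nonneg ha _) _)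
    rw [← Finset.sum_mul]
    exact mul_le_mul_of_nonneg_right (hcol i) (hx i)
  have hS : 0 ≤ ∑ i, |x i| ^ p := Finset.sum_nonneg fun i _ => hx i
  have ha' : 0 ≤ a ^ (1 - p⁻¹) := Real.rpow_nonneg ha _
  refine (Real.rpow_le_rpow (Finset.sum_nonneg fun j _ => Real.rpow_nonneg (abs_nonneg _) p) hsum
    (by positivity)).trans_eq ?_
  rw [Real.mul_rpow (Real.rpow_nonneg ha' _) (mul_nonneg hb hS), Real.mul_rpow hb hS,
    ← Real.rpow_mul ha', mul_one_div_cancel hp0.ne', Real.rpow_one, one_div, mul_assoc]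

lemma specPNorm_nonneg {n : ℕ} (p : ℝ≥0∞) (A : Matrix (Fin n) (Fin n) ℂ) : 0 ≤ specPNorm p A := by
  unfold specPNorm
  split_ifs
  · exact Real.iSup_nonneg fun i => abs_nonneg _
  · exact Real.rpow_nonneg (Finset.sum_nonneg fun i _ => Real.rpow_nonneg (abs_nonneg _) _) _
  · exact le_rfl

lemma specPNorm_of_ne_top {n : ℕ} {p : ℝ≥0∞} (hp : p ≠ ∞) {A : Matrix (Fin n) (Fin n) ℂ}
    (hA : A.IsHermitian) :
    specPNorm p A = (∑ i, |hA.eigenvalues i| ^ p.toReal) ^ (1 / p.toReal) := by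
  rw [specPNorm, dif_pos hA, if_neg hp]

lemma specPNorm_top {n : ℕ} {A : Matrix (Fin n) (Fin n) ℂ} (hA : A.IsHermitian) :
    specPNorm ∞ A = ⨆ i, |hA.eigenvalues i| := by
  rw [specPNorm, dif_pos hA, if_pos rfl]

/-- The spectral norms decrease in the exponent. -/
lemma specPNorm_antitone {n : ℕ} {r s : ℝ≥0∞} (hr : 0 < r) (hrs : r ≤ s)
    (A : Matrix (Fin n) (Fin n) ℂ) : specPNorm s A ≤ specPNorm r A := by
  rcases eq_or_ne r ∞ with rfl | hrt
  · rw [top_le_iff.1 hrs]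
  by_cases hA : A.IsHermitian
  swap
  · simp [specPNorm, hA]
  have hr0 : 0 < r.toReal := ENNReal.toReal_pos hr.ne' hrt
  rcases eq_or_ne s ∞ with rfl | hst
  · rw [specPNorm_top hA]
    refine Real.iSup_le (fun i => ?_) (specPNorm_nonneg r A)
    rw [specPNorm_of_ne_top hrt hA]
    calc |hA.eigenvalues i| = (|hA.eigenvalues i| ^ r.toReal) ^ (1 / r.toReal) := by
          rw [← Real.rpow_mul (abs_nonneg _), mul_one_div_cancel hr0.ne', Real.rpow_one]
      _ ≤ _ := Real.rpow_le_rpow (Real.rpow_nonneg (abs_nonneg _) _)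
          (Finset.single_le_sum (f := fun i => |hA.eigenvalues i| ^ r.toReal)
            (fun j _ => Real.rpow_nonneg (abs_nonneg _) _) (Finset.mem_univ i)) (by positivity)
  · rw [specPNorm_of_ne_top hst hA, specPNorm_of_ne_top hrt hA]
    exact sum_rpow_rpow_inv_le (fun i => abs_nonneg _) hr0 (ENNReal.toReal_mono hst hrs)

/-- A Hermitian matrix in diagonalized form. -/
lemma Matrix.IsHermitian.eq_unitary_mul_diagonal_mul {n : ℕ} {A : Matrix (Fin n) (Fin n) ℂ}
    (hA : A.IsHermitian) :
    A = (hA.eigenvectorUnitary : Matrix (Fin n) (Fin n) ℂ) *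
      diagonal (fun i => (hA.eigenvalues i : ℂ)) *
        (hA.eigenvectorUnitary : Matrix (Fin n) (Fin n) ℂ)ᴴ := by
  have h := hA.spectral_theorem
  rw [Unitary.conjStarAlgAut_apply] at h
  exact h

/-- Diagonal entries of a Hermitian matrix in any orthonormal basis are bounded by its spectral
`∞`-norm. -/
lemma re_conj_apply_le_specPNorm_top {n : ℕ} {A V : Matrix (Fin n) (Fin n) ℂ}
    (hA : A.IsHermitian) (hV : Vᴴ * V = 1) (j : Fin n) :
    ((Vᴴ * A * V) j j).re ≤ specPNorm ∞ A := by
  set c := specPNorm ∞ A with hc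
  set U : Matrix (Fin n) (Fin n) ℂ := hA.eigenvectorUnitary.val with hU
  have hle (i : Fin n) : hA.eigenvalues i ≤ c := by
    rw [hc, specPNorm_top hA]
    exact (le_abs_self _).trans
      (le_ciSup (f := fun i => |hA.eigenvalues i|) (Set.finite_range _).bddAbove i)
  have hUU : U * Uᴴ = 1 := Unitary.coe_mul_star_self hA.eigenvectorUnitary
  have hsub : (c : ℂ) • (1 : Matrix (Fin n) (Fin n) ℂ) - A =
      U * diagonal (fun i => (c : ℂ) - (hA.eigenvalues i : ℂ)) * Uᴴ := by
    have hd : diagonal (fun i => (c : ℂ) - (hA.eigenvalues i : ℂ)) =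
        (c : ℂ) • (1 : Matrix (Fin n) (Fin n) ℂ) - diagonal (fun i => (hA.eigenvalues i : ℂ)) := by
      rw [smul_one_eq_diagonal, diagonal_sub]
    rw [hd, mul_sub, sub_mul, ← hA.eq_unitary_mul_diagonal_mul, mul_smul_comm, mul_one,
      smul_mul_assoc, hUU]
  have hpsd : ((c : ℂ) • (1 : Matrix (Fin n) (Fin n) ℂ) - A).PosSemidef := by
    rw [hsub]
    refine PosSemidef.mul_mul_conjTranspose_same (posSemidef_diagonal_iff.2 fun i => ?_) U
    rw [← Complex.ofReal_sub]
    exact Complex.zero_le_real.2 (sub_nonneg.2 (hle i))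
  have h := (hpsd.conjTranspose_mul_mul_same V).diag_nonneg (i := j)
  rw [mul_sub, sub_mul, mul_smul_comm, mul_one, smul_mul_assoc, hV] at h
  have h' := (Complex.nonneg_iff.1 h).1
  simpa using h'

section PositiveMap

variable {n : ℕ} {P Pstar : Matrix (Fin n) (Fin n) ℂ →ₗ[ℝ] Matrix (Fin n) (Fin n) ℂ}

/-- The spectral projections of a Hermitian matrix onto the vectors of an eigenbasis. -/
noncomputable def Matrix.IsHermitian.spectralProj {A : Matrix (Fin n) (Fin n) ℂ}
    (hA : A.IsHermitian) (i : Fin n) : Matrix (Fin n) (Fin n) ℂ :=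
  (hA.eigenvectorUnitary : Matrix (Fin n) (Fin n) ℂ) * single i i 1 *
    (hA.eigenvectorUnitary : Matrix (Fin n) (Fin n) ℂ)ᴴ

lemma Matrix.IsHermitian.spectralProj_posSemidef {A : Matrix (Fin n) (Fin n) ℂ}
    (hA : A.IsHermitian) (i : Fin n) : (hA.spectralProj i).PosSemidef := by
  refine PosSemidef.mul_mul_conjTranspose_same ?_ _
  rw [← diagonal_single]
  refine posSemidef_diagonal_iff.2 fun k => ?_
  rw [Pi.single_apply]
  split_ifs <;> simp

lemma Matrix.IsHermitian.sum_smul_spectralProj {A : Matrix (Fin n) (Fin n) ℂ}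
    (hA : A.IsHermitian) : ∑ i, hA.eigenvalues i • hA.spectralProj i = A := by
  conv_rhs => rw [hA.eq_unitary_mul_diagonal_mul, ← sum_single_eq_diagonal]
  simp only [spectralProj, Finset.mul_sum, Finset.sum_mul]
  refine Finset.sum_congr rfl fun i _ => ?_
  rw [← smul_mul_assoc, ← mul_smul_comm, smul_single]
  simp

lemma Matrix.IsHermitian.sum_spectralProj {A : Matrix (Fin n) (Fin n) ℂ}
    (hA : A.IsHermitian) : ∑ i, hA.spectralProj i = 1 := by
  simp only [spectralProj, ← Finset.mul_sum, ← Finset.sum_mul]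
  rw [sum_single_eq_diagonal (fun _ => (1 : ℂ)), diagonal_one, mul_one]
  exact Unitary.coe_mul_star_self hA.eigenvectorUnitary

/-- A positive map preserves Hermitian matrices. -/
lemma isHermitian_map_of_posSemidef
    (hP : ∀ X : Matrix (Fin n) (Fin n) ℂ, X.PosSemidef → (P X).PosSemidef)
    {A : Matrix (Fin n) (Fin n) ℂ} (hA : A.IsHermitian) : (P A).IsHermitian := by
  have h : P A = ∑ i, hA.eigenvalues i • P (hA.spectralProj i) := by
    conv_lhs => rw [← hA.sum_smul_spectralProj]
    simp
  rw [IsHermitian, h, conjTranspose_sum]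
  refine Finset.sum_congr rfl fun i _ => ?_
  rw [conjTranspose_smul, (hP _ (hA.spectralProj_posSemidef i)).isHermitian.eq, star_trivial]

/-- The trace adjoint of a positive map sends the identity to a Hermitian matrix. -/
lemma isHermitian_adjoint_one
    (hP : ∀ X : Matrix (Fin n) (Fin n) ℂ, X.PosSemidef → (P X).PosSemidef)
    (hadj : ∀ X Y : Matrix (Fin n) (Fin n) ℂ, X.IsHermitian → Y.IsHermitian →
      (P X * Y).trace = (X * Pstar Y).trace) : (Pstar 1).IsHermitian := by
  set Z := Pstar 1 with hZ
  have htr {X : Matrix (Fin n) (Fin n) ℂ} (hX : X.IsHermitian) : (X * (Z - Zᴴ)).trace = 0 := by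
    have h1 := hadj X 1 hX isHermitian_one
    rw [mul_one] at h1
    have h2 : (X * Zᴴ).trace = (X * Z).trace := by
      rw [← h1, ← (isHermitian_map_of_posSemidef hP hX).eq, trace_conjTranspose, h1,
        ← trace_conjTranspose, conjTranspose_mul, hX.eq, trace_mul_comm]
    rw [mul_sub, trace_sub, h2, sub_self]
  have hB : (Complex.I • (Z - Zᴴ)).IsHermitian := by
    rw [IsHermitian, conjTranspose_smul, conjTranspose_sub, conjTranspose_conjTranspose,
      ← neg_sub Z, Complex.star_def, Complex.conj_I, smul_neg, neg_smul, neg_neg]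
  have h := htr hB
  have h0 : ((Z - Zᴴ)ᴴ * (Z - Zᴴ)).trace = 0 := by
    rw [smul_mul_assoc, trace_smul, smul_eq_zero] at h
    rw [conjTranspose_sub, conjTranspose_conjTranspose, ← neg_sub Z, neg_mul, trace_neg,
      h.resolve_left Complex.I_ne_zero, neg_zero]
  exact (sub_eq_zero.1 (trace_conjTranspose_mul_self_eq_zero_iff.1 h0)).symm

/-- A positive map is bounded on the spectral `r`-norm, with the interpolated constant between
its `∞`-norm and its `1`-norm. -/
lemma specPNorm_map_le {r : ℝ≥0∞} (hr : 1 ≤ r) (hrt : r ≠ ∞)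
    (hP : ∀ X : Matrix (Fin n) (Fin n) ℂ, X.PosSemidef → (P X).PosSemidef)
    (hadj : ∀ X Y : Matrix (Fin n) (Fin n) ℂ, X.IsHermitian → Y.IsHermitian →
      (P X * Y).trace = (X * Pstar Y).trace)
    {A : Matrix (Fin n) (Fin n) ℂ} (hA : A.IsHermitian) :
    specPNorm r (P A) ≤
      specPNorm ∞ (P 1) ^ (1 - 1 / r.toReal) * specPNorm ∞ (Pstar 1) ^ (1 / r.toReal) *
        specPNorm r A := by
  have hPA := isHermitian_map_of_posSemidef hP hA
  set U : Matrix (Fin n) (Fin n) ℂ := hA.eigenvectorUnitary.val with hU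
  set V : Matrix (Fin n) (Fin n) ℂ := hPA.eigenvectorUnitary.val with hV
  have hUU : Uᴴ * U = 1 := Unitary.coe_star_mul_self hA.eigenvectorUnitary
  have hVV : Vᴴ * V = 1 := Unitary.coe_star_mul_self hPA.eigenvectorUnitary
  have hVV' : V * Vᴴ = 1 := Unitary.coe_mul_star_self hPA.eigenvectorUnitary
  have hμ (j : Fin n) : hPA.eigenvalues j =
      ∑ i, ((Vᴴ * P (hA.spectralProj i) * V) j j).re * hA.eigenvalues i := by
    have h1 : Vᴴ * P A * V = diagonal (fun i => (hPA.eigenvalues i : ℂ)) := by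
      have h := hPA.eq_unitary_mul_diagonal_mul
      rw [← hV] at h
      calc Vᴴ * P A * V
          = (Vᴴ * V) * diagonal (fun i => (hPA.eigenvalues i : ℂ)) * (Vᴴ * V) := by
            conv_lhs => rw [h]
            simp only [mul_assoc]
        _ = _ := by rw [hVV, one_mul, mul_one]
    have h2 : Vᴴ * P A * V =
        ∑ i, hA.eigenvalues i • (Vᴴ * P (hA.spectralProj i) * V) := by
      conv_lhs => rw [← hA.sum_smul_spectralProj]
      simp [Finset.mul_sum, Finset.sum_mul]
    have h3 := congrArg (fun X : Matrix (Fin n) (Fin n) ℂ => (X j j).re) (h1.symm.trans h2)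
    simpa [Matrix.sum_apply, mul_comm] using h3
  rw [specPNorm_of_ne_top hrt hPA, specPNorm_of_ne_top hrt hA]
  simp only [hμ]
  refine schur_test (fun j i => ?_) (specPNorm_nonneg _ _) (specPNorm_nonneg _ _)
    (by simpa using ENNReal.toReal_mono hrt hr) (fun j => ?_) (fun i => ?_) _
  · exact (Complex.nonneg_iff.1 (((hP _ (hA.spectralProj_posSemidef i)).conjTranspose_mul_mul_same
      V).diag_nonneg (i := j))).1
  · have h : ∑ i, ((Vᴴ * P (hA.spectralProj i) * V) j j).re = ((Vᴴ * P 1 * V) j j).re := by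
      rw [← hA.sum_spectralProj, map_sum, Finset.mul_sum, Finset.sum_mul, Matrix.sum_apply,
        Complex.re_sum]
    rw [h]
    exact re_conj_apply_le_specPNorm_top (isHermitian_map_of_posSemidef hP isHermitian_one) hVV j
  · have h : ∑ j, ((Vᴴ * P (hA.spectralProj i) * V) j j).re = ((Uᴴ * Pstar 1 * U) i i).re := by
      have h1 := hadj _ 1 (hA.spectralProj_posSemidef i).isHermitian isHermitian_one
      have h2 : (Vᴴ * P (hA.spectralProj i) * V).trace = (Uᴴ * Pstar 1 * U) i i := by
        rw [trace_mul_comm, ← mul_assoc, hVV', one_mul, ← mul_one (P _), h1,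
          IsHermitian.spectralProj, ← hU, mul_assoc, mul_assoc, trace_mul_comm, mul_assoc,
          trace_single_mul, one_smul]
      rw [← h2, trace, Complex.re_sum]
      rfl
    rw [h]
    exact re_conj_apply_le_specPNorm_top (isHermitian_adjoint_one hP hadj) hUU i

end PositiveMap

/-- Norm estimate for a positive linear transformation `P` on Hermitian matrices, case `r < s`:
`‖P‖_{r→s} ≤ 2√2 ‖P(I)‖_∞^{1-1/r} ‖P*(I)‖_∞^{1/r}`, where `P*` is the adjoint of `P` with
respect to the trace inner product. -/
theorem positive_map_norm_r_lt_s {n : ℕ} (r s : ℝ≥0∞) (hr : 1 ≤ r) (hrs : r < s)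
    (P Pstar : Matrix (Fin n) (Fin n) ℂ →ₗ[ℝ] Matrix (Fin n) (Fin n) ℂ)
    (hP : ∀ X : Matrix (Fin n) (Fin n) ℂ, X.PosSemidef → (P X).PosSemidef)
    (hadj : ∀ X Y : Matrix (Fin n) (Fin n) ℂ, X.IsHermitian → Y.IsHermitian →
      (P X * Y).trace = (X * Pstar Y).trace) :
    hermOpNorm r s P ≤
      2 * Real.sqrt 2 * specPNorm ∞ (P 1) ^ (1 - (1 / r).toReal) *
        specPNorm ∞ (Pstar 1) ^ (1 / r).toReal := by
  have hrt : r ≠ ∞ := hrs.ne_top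
  have hconst : (1 : ℝ) ≤ 2 * Real.sqrt 2 := by
    have : (1 : ℝ) ≤ Real.sqrt 2 := Real.one_le_sqrt.2 one_le_two
    linarith
  have hinv : (1 / r).toReal = 1 / r.toReal := by simp
  rw [hinv, mul_assoc]
  have hK : 0 ≤ specPNorm ∞ (P 1) ^ (1 - 1 / r.toReal) *
      specPNorm ∞ (Pstar 1) ^ (1 / r.toReal) :=
    mul_nonneg (Real.rpow_nonneg (specPNorm_nonneg _ _) _)
      (Real.rpow_nonneg (specPNorm_nonneg _ _) _)
  refine le_trans ?_ (le_mul_of_one_le_left hK hconst)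
  refine Real.iSup_le (fun A => ?_) hK
  refine div_le_of_le_mul₀ (specPNorm_nonneg _ _) hK ?_
  exact (specPNorm_antitone (zero_lt_one.trans_le hr) hrs.le _).trans
    (specPNorm_map_le hr hrt hP hadj A.2.1)
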